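/- Let 1 ≤ N ≤ p with p > 1. If u : ℝ^N → ℝ is a C¹ function that is bounded below and satisfies ∫_{ℝ^N} |∇u(x)|^{p−2}⟨∇u(x), ∇φ(x)⟩ dx ≥ 0 for every nonnegative C^∞ compactly supported φ : ℝ^N → ℝ, then u is constant. -/

import Mathlib

open MeasureTheory Metric
open scoped RealInnerProductSpace

lemma young_aux (p : ℝ) (hp : 1 < p) (a b : ℝ) (ha : 0 ≤ a) (hb : 0 ≤ b) :
    p * a ^ (p - 1) * b ≤ (p - 1) / 2 * a ^ p + p * (2 * p / (p - 1)) ^ (p - 1) * b ^ p := by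
  have hp1 : 0 < p - 1 := by linarith
  have key : ∀ c : ℝ, 0 ≤ c → c ^ p = c ^ (p - 1) * c := by
    intro c hc
    rcases hc.eq_or_lt with rfl | hc
    · rw [Real.zero_rpow (by linarith)]; simp
    · rw [← Real.rpow_add_one hc.ne']; congr 1; ring
  have h1 : 0 ≤ a ^ (p - 1) := Real.rpow_nonneg ha _
  have h2 : 0 ≤ b ^ (p - 1) := Real.rpow_nonneg hb _
  have hK : 0 ≤ (2 * p / (p - 1)) := by positivity
  have h3 : 0 ≤ (2 * p / (p - 1)) ^ (p - 1) := Real.rpow_nonneg hK _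
  rw [key a ha, key b hb]
  rcases le_total (p * b) ((p - 1) / 2 * a) with h | h
  · have : a ^ (p - 1) * (p * b) ≤ a ^ (p - 1) * ((p - 1) / 2 * a) := by gcongr
    have : 0 ≤ p * (2 * p / (p - 1)) ^ (p - 1) * (b ^ (p - 1) * b) := by positivity
    linarith
  · have hab : a ≤ 2 * p / (p - 1) * b := by
      rw [div_mul_eq_mul_div, le_div_iff₀ hp1]; linarith
    have : a ^ (p - 1) ≤ (2 * p / (p - 1)) ^ (p - 1) * b ^ (p - 1) := by
      rw [← Real.mul_rpow hK hb]
      exact Real.rpow_le_rpow ha hab hp1.le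
    have : p * b * a ^ (p - 1) ≤ p * b * ((2 * p / (p - 1)) ^ (p - 1) * b ^ (p - 1)) := by gcongr
    have : 0 ≤ (p - 1) / 2 * (a ^ (p - 1) * a) := by positivity
    linarith

lemma norm_gradient_eq {E : Type*} [NormedAddCommGroup E] [InnerProductSpace ℝ E] [CompleteSpace E]
    (f : E → ℝ) (x : E) : ‖gradient f x‖ = ‖fderiv ℝ f x‖ := by
  simp [gradient]

lemma continuous_gradient_of {E : Type*} [NormedAddCommGroup E] [InnerProductSpace ℝ E]
    [CompleteSpace E] (f : E → ℝ) (hf : ContDiff ℝ 1 f) : Continuous (gradient f) := by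
  unfold gradient
  exact (LinearIsometryEquiv.continuous _).comp (hf.continuous_fderiv one_ne_zero)

lemma gradient_zero_of_notMem {E : Type*} [NormedAddCommGroup E] [InnerProductSpace ℝ E]
    [CompleteSpace E] (f : E → ℝ) {K : Set E} (hK : tsupport f ⊆ K) {x : E} (hx : x ∉ K) :
    gradient f x = 0 := by
  have : fderiv ℝ f x = 0 := by
    by_contra h
    exact hx (hK (support_fderiv_subset ℝ h))
  simp [gradient, this]

lemma smooth_approx {N : ℕ} (φ : EuclideanSpace ℝ (Fin N) → ℝ) (hφ : ContDiff ℝ 1 φ)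
    (hc : HasCompactSupport φ) (h0 : ∀ x, 0 ≤ φ x) (ε : ℝ) (hε : 0 < ε) :
    ∃ ψ : EuclideanSpace ℝ (Fin N) → ℝ, ContDiff ℝ (⊤ : ℕ∞) ψ ∧ HasCompactSupport ψ ∧
      (∀ x, 0 ≤ ψ x) ∧ tsupport ψ ⊆ cthickening 1 (tsupport φ) ∧
      ∀ x, ‖gradient ψ x - gradient φ x‖ ≤ ε := by
  have hcont : Continuous (fderiv ℝ φ) := hφ.continuous_fderiv one_ne_zero
  have huc : UniformContinuous (fderiv ℝ φ) :=
    (hc.fderiv ℝ).uniformContinuous_of_continuous hcont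
  obtain ⟨δ, hδ, hδ'⟩ := Metric.uniformContinuous_iff.1 huc ε hε
  let b : ContDiffBump (0 : EuclideanSpace ℝ (Fin N)) :=
    ⟨min δ 1 / 2, min δ 1, by positivity, by
      have : 0 < min δ 1 := by positivity
      linarith⟩
  have hb1 : b.rOut = min δ 1 := rfl
  set ψ := convolution (b.normed volume) φ (ContinuousLinearMap.lsmul ℝ ℝ) volume with hψ
  have hsub : Function.support ψ ⊆ cthickening 1 (tsupport φ) := by
    refine (support_convolution_subset _).trans ?_
    rw [b.support_normed_eq]
    rintro x ⟨y, hy, z, hz, rfl⟩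
    refine mem_cthickening_of_dist_le _ z _ _ (subset_tsupport _ hz) ?_
    have : ‖y‖ < min δ 1 := by simpa [hb1] using hy
    simpa using (this.trans_le (min_le_right _ _)).le
  refine ⟨ψ, ?_, ?_, ?_, closure_minimal hsub isClosed_cthickening, ?_⟩
  · exact b.hasCompactSupport_normed.contDiff_convolution_left _ b.contDiff_normed
      hφ.continuous.locallyIntegrable
  · exact b.hasCompactSupport_normed.convolution _ hc
  · intro x
    exact integral_nonneg fun t => by
      simpa using mul_nonneg (b.nonneg_normed t) (h0 _)
  · intro x
    have h1 := hc.hasFDerivAt_convolution_right (ContinuousLinearMap.lsmul ℝ ℝ)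
      (μ := volume) (f := b.normed volume) b.continuous_normed.locallyIntegrable hφ x
    have hL : (ContinuousLinearMap.lsmul ℝ ℝ : ℝ →L[ℝ] ℝ →L[ℝ] ℝ).precompR (EuclideanSpace ℝ (Fin N)) =
      ContinuousLinearMap.lsmul ℝ ℝ := by
      ext; simp [ContinuousLinearMap.precompR]
    rw [hL] at h1
    have h2 := b.dist_normed_convolution_le (μ := volume) (g := fderiv ℝ φ) (x₀ := x) (ε := ε)
      hcont.aestronglyMeasurable (fun y hy => (hδ' ((mem_ball.1 hy).trans_le (min_le_left _ _))).le)
    rw [← h1.fderiv, dist_eq_norm] at h2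
    simp only [gradient]
    rw [← map_sub, LinearIsometryEquiv.norm_map]
    exact h2

lemma norm_field {E : Type*} [NormedAddCommGroup E] (p : ℝ) (hp : 1 < p) (z : E) :
    ‖z‖ ^ (p - 2) * ‖z‖ = ‖z‖ ^ (p - 1) := by
  rcases eq_or_ne z 0 with rfl | hz
  · rw [norm_zero, mul_zero, Real.zero_rpow (by linarith)]
  · rw [← Real.rpow_add_one (by simpa using hz)]; congr 1; ring

lemma integrable_field {N : ℕ} (p : ℝ) (hp : 1 < p) (u φ : EuclideanSpace ℝ (Fin N) → ℝ)
    (hu : ContDiff ℝ 1 u) (hφ : ContDiff ℝ 1 φ) (hc : HasCompactSupport φ) :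
    Integrable (fun x => ‖gradient u x‖ ^ (p - 2) * ⟪gradient u x, gradient φ x⟫) := by
  have c1 := continuous_gradient_of u hu
  have c2 := continuous_gradient_of φ hφ
  have hi : Integrable (fun x => ‖gradient u x‖ ^ (p - 1) * ‖gradient φ x‖) := by
    refine Continuous.integrable_of_hasCompactSupport ?_ ?_
    · exact (c1.norm.rpow_const fun x => Or.inr (by linarith)).mul c2.norm
    · refine HasCompactSupport.intro hc (fun x hx => ?_)
      rw [gradient_zero_of_notMem φ subset_rfl hx]; simp
  refine hi.mono' ?_ (Filter.Eventually.of_forall fun x => ?_)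
  · exact ((c1.norm.measurable.pow_const _).mul (c1.inner c2).measurable).aestronglyMeasurable
  · rw [norm_mul, Real.norm_of_nonneg (Real.rpow_nonneg (norm_nonneg _) _), ← norm_field p hp,
      mul_assoc]
    gcongr
    exact norm_inner_le_norm _ _

lemma extend_test {N : ℕ} (p : ℝ) (hp : 1 < p) (u : EuclideanSpace ℝ (Fin N) → ℝ)
    (hu : ContDiff ℝ 1 u)
    (hsuper : ∀ φ : EuclideanSpace ℝ (Fin N) → ℝ,
      ContDiff ℝ (⊤ : ℕ∞) φ → HasCompactSupport φ → (∀ x, 0 ≤ φ x) →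
      0 ≤ ∫ x, ‖gradient u x‖ ^ (p - 2) * ⟪gradient u x, gradient φ x⟫)
    (φ : EuclideanSpace ℝ (Fin N) → ℝ) (hφ : ContDiff ℝ 1 φ)
    (hc : HasCompactSupport φ) (h0 : ∀ x, 0 ≤ φ x) :
    0 ≤ ∫ x, ‖gradient u x‖ ^ (p - 2) * ⟪gradient u x, gradient φ x⟫ := by
  have c1 := continuous_gradient_of u hu
  set K := cthickening 1 (tsupport φ) with hKdef
  have hK : IsCompact K := hc.isCompact.cthickening
  have hcK : Continuous (fun x => ‖gradient u x‖ ^ (p - 1)) :=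
    c1.norm.rpow_const fun x => Or.inr (by linarith)
  have hIK : IntegrableOn (fun x => ‖gradient u x‖ ^ (p - 1)) K := hcK.continuousOn.integrableOn_compact hK
  set A := ∫ x in K, ‖gradient u x‖ ^ (p - 1) with hA
  have hA0 : 0 ≤ A := integral_nonneg fun x => Real.rpow_nonneg (norm_nonneg _) _
  have main : ∀ ε > 0, -(ε * A) ≤
      ∫ x, ‖gradient u x‖ ^ (p - 2) * ⟪gradient u x, gradient φ x⟫ := by
    intro ε hε
    obtain ⟨ψ, s1, s2, s3, s4, s5⟩ := smooth_approx φ hφ hc h0 ε hε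
    have hψ := hsuper ψ s1 s2 s3
    have i1 := integrable_field p hp u φ hu hφ hc
    have i2 := integrable_field p hp u ψ hu (s1.of_le (by exact_mod_cast le_top)) s2
    have i3 : Integrable (K.indicator fun x => ε * ‖gradient u x‖ ^ (p - 1)) :=
      (IntegrableOn.integrable_indicator (hIK.const_mul ε) hK.measurableSet)
    have hle : ∫ x, ‖gradient u x‖ ^ (p - 2) * ⟪gradient u x, gradient ψ x⟫ ≤
        ∫ x, (‖gradient u x‖ ^ (p - 2) * ⟪gradient u x, gradient φ x⟫ +
          K.indicator (fun x => ε * ‖gradient u x‖ ^ (p - 1)) x) := by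
      refine integral_mono i2 (i1.add i3) fun x => ?_
      by_cases hx : x ∈ K
      · simp only [Set.indicator_of_mem hx]
        rw [← norm_field p hp, ← sub_le_iff_le_add', ← mul_sub, ← inner_sub_right]
        calc _ ≤ ‖gradient u x‖ ^ (p - 2) * (‖gradient u x‖ * ε) := by
              gcongr
              exact (real_inner_le_norm _ _).trans (by gcongr; exact s5 x)
          _ = _ := by ring
      · simp only [Set.indicator_of_notMem hx]
        rw [gradient_zero_of_notMem ψ s4 hx,
          gradient_zero_of_notMem φ (self_subset_cthickening _) hx]
        simp
    rw [integral_add i1 i3, integral_indicator hK.measurableSet, integral_const_mul] at hle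
    linarith
  by_contra hneg
  push Not at hneg
  set I := ∫ x, ‖gradient u x‖ ^ (p - 2) * ⟪gradient u x, gradient φ x⟫
  have := main (-I / (2 * (A + 1))) (by apply div_pos <;> linarith)
  have h2 : -I / (2 * (A + 1)) * A ≤ -I / 2 := by
    rw [div_mul_eq_mul_div, div_le_div_iff₀ (by linarith) (by norm_num)]
    nlinarith
  linarith

lemma caccioppoli {N : ℕ} (p : ℝ) (hp : 1 < p) (u : EuclideanSpace ℝ (Fin N) → ℝ)
    (hu : ContDiff ℝ 1 u) (M : ℝ) (hM : ∀ x, M ≤ u x)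
    (hsuper : ∀ φ : EuclideanSpace ℝ (Fin N) → ℝ,
      ContDiff ℝ (⊤ : ℕ∞) φ → HasCompactSupport φ → (∀ x, 0 ≤ φ x) →
      0 ≤ ∫ x, ‖gradient u x‖ ^ (p - 2) * ⟪gradient u x, gradient φ x⟫)
    (η : EuclideanSpace ℝ (Fin N) → ℝ) (hη : ContDiff ℝ 1 η)
    (hc : HasCompactSupport η) (h0 : ∀ x, 0 ≤ η x) :
    (p - 1) / 2 * ∫ x, (η x * ‖gradient u x‖ / (u x - M + 1)) ^ p ≤
      p * (2 * p / (p - 1)) ^ (p - 1) * ∫ x, ‖gradient η x‖ ^ p := by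
  have hp0 : 0 < p := by linarith
  have c1 := continuous_gradient_of u hu
  have c2 := continuous_gradient_of η hη
  have hv : ∀ x, 0 < u x - M + 1 := fun x => by linarith [hM x]
  have hvC : ContDiff ℝ 1 (fun x => u x - M + 1) := (hu.sub contDiff_const).add contDiff_const
  let φ : EuclideanSpace ℝ (Fin N) → ℝ := fun x => η x ^ p * (u x - M + 1) ^ (1 - p)
  have hφ : ContDiff ℝ 1 φ := by
    refine ContDiff.mul ?_ (hvC.rpow_const_of_ne fun x => (hv x).ne')
    exact_mod_cast ContDiff.rpow_const_of_le (m := 1) (by exact_mod_cast hη) (by simpa using hp.le)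
  have hφc : HasCompactSupport φ := by
    refine HasCompactSupport.intro hc (fun x hx => ?_)
    simp [φ, image_eq_zero_of_notMem_tsupport hx, Real.zero_rpow hp0.ne']
  have hφ0 : ∀ x, 0 ≤ φ x := fun x => 
    mul_nonneg (Real.rpow_nonneg (h0 x) _) (Real.rpow_nonneg (hv x).le _)
  have h := extend_test p hp u hu hsuper φ hφ hφc hφ0
  have i1 : Integrable (fun x => (η x * ‖gradient u x‖ / (u x - M + 1)) ^ p) := by
    refine Continuous.integrable_of_hasCompactSupport ?_ ?_
    · refine Continuous.rpow_const ?_ fun x => Or.inr hp0.le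
      exact (hη.continuous.mul c1.norm).div hvC.continuous fun x => (hv x).ne'
    · refine HasCompactSupport.intro hc (fun x hx => ?_)
      simp [image_eq_zero_of_notMem_tsupport hx, Real.zero_rpow hp0.ne']
  have i2 : Integrable (fun x => ‖gradient η x‖ ^ p) := by
    refine Continuous.integrable_of_hasCompactSupport ?_ ?_
    · exact Continuous.rpow_const c2.norm fun x => Or.inr hp0.le
    · refine HasCompactSupport.intro hc (fun x hx => ?_)
      simp [gradient_zero_of_notMem η subset_rfl hx, Real.zero_rpow hp0.ne']
  have hle : ∫ x, ‖gradient u x‖ ^ (p - 2) * ⟪gradient u x, gradient φ x⟫ ≤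
      ∫ x, (p * (2 * p / (p - 1)) ^ (p - 1) * ‖gradient η x‖ ^ p -
        (p - 1) / 2 * (η x * ‖gradient u x‖ / (u x - M + 1)) ^ p) := by
    refine integral_mono (integrable_field p hp u φ hu hφ hφc)
      ((i2.const_mul _).sub (i1.const_mul _)) fun x => ?_
    simp only
    set z := gradient u x with hz
    set v := u x - M + 1 with hvx
    have hv0 : 0 < v := hv x
    have dη := (hη.differentiable one_ne_zero x).hasFDerivAt
    have dv : HasFDerivAt (fun x => u x - M + 1) (fderiv ℝ u x) x :=
      ((hu.differentiable one_ne_zero x).hasFDerivAt.sub_const M).add_const 1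
    have dφ : HasFDerivAt φ _ x := (dη.rpow_const (p := p) (Or.inr hp.le)).mul
      (dv.rpow_const (p := 1 - p) (Or.inl (hv x).ne'))
    have hin : ⟪z, gradient φ x⟫ = η x ^ p * ((1 - p) * v ^ (-p)) * ‖z‖ ^ 2 +
        v ^ (1 - p) * (p * η x ^ (p - 1)) * ⟪gradient η x, z⟫ := by
      rw [real_inner_comm, inner_gradient_left, dφ.fderiv, inner_gradient_left]
      simp only [_root_.add_apply, _root_.smul_apply, smul_eq_mul]
      rw [← inner_gradient_left, ← hz, real_inner_self_eq_norm_sq,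
        show 1 - p - 1 = -p by ring]
      ring
    have yg := young_aux p hp (η x * ‖z‖ / v) ‖gradient η x‖
      (div_nonneg (mul_nonneg (h0 x) (norm_nonneg _)) hv0.le) (norm_nonneg _)
    have e1 : ‖z‖ ^ (p - 2) * ‖z‖ ^ 2 = ‖z‖ ^ p := by
      rw [pow_two, ← mul_assoc, norm_field p hp]
      rcases eq_or_ne z 0 with hz0 | hz0
      · rw [hz0, norm_zero, mul_zero, Real.zero_rpow (by linarith)]
      · rw [← Real.rpow_add_one (by simpa using hz0)]; congr 1; ring
    have e2 : (η x * ‖z‖ / v) ^ p = η x ^ p * ‖z‖ ^ p * v ^ (-p) := by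
      rw [Real.div_rpow (mul_nonneg (h0 x) (norm_nonneg _)) hv0.le,
        Real.mul_rpow (h0 x) (norm_nonneg _), Real.rpow_neg hv0.le]; rfl
    have e3 : (η x * ‖z‖ / v) ^ (p - 1) = η x ^ (p - 1) * ‖z‖ ^ (p - 1) * v ^ (1 - p) := by
      rw [Real.div_rpow (mul_nonneg (h0 x) (norm_nonneg _)) hv0.le,
        Real.mul_rpow (h0 x) (norm_nonneg _), show 1 - p = -(p - 1) by ring,
        Real.rpow_neg hv0.le]; rfl
    have e4 : ‖z‖ ^ (p - 2) * ⟪gradient η x, z⟫ ≤ ‖z‖ ^ (p - 1) * ‖gradient η x‖ := by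
      rw [← norm_field p hp, mul_assoc, mul_comm ‖z‖ ‖gradient η x‖]
      gcongr
      exact real_inner_le_norm _ _
    have e5 : 0 ≤ v ^ (1 - p) * (p * η x ^ (p - 1)) := by
      have := Real.rpow_nonneg (h0 x) (p - 1)
      positivity
    have e6 := mul_le_mul_of_nonneg_left e4 e5
    rw [hin, mul_add]
    have e7 : ‖z‖ ^ (p - 2) * (η x ^ p * ((1 - p) * v ^ (-p)) * ‖z‖ ^ 2) =
        -((p - 1) * (η x * ‖z‖ / v) ^ p) := by
      rw [e2, ← e1]; ring
    rw [e7]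
    rw [e3] at yg
    linarith
  rw [integral_sub (i2.const_mul _) (i1.const_mul _), integral_const_mul, integral_const_mul] at hle
  linarith

lemma smoothTransition_deriv_bound : ∃ C : ℝ, 0 < C ∧ ∀ x, |deriv Real.smoothTransition x| ≤ C := by
  have hcont : Continuous (deriv Real.smoothTransition) :=
    (Real.smoothTransition.contDiff (n := 1)).continuous_deriv le_rfl
  obtain ⟨C, hC⟩ := (isCompact_Icc (a := (0:ℝ)) (b := 1)).exists_bound_of_continuousOn
    hcont.continuousOn
  refine ⟨max C 1, by positivity, fun x => ?_⟩
  by_cases hx : x ∈ Set.Icc (0:ℝ) 1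
  · exact (hC x hx).trans (le_max_left _ _)
  · have : deriv Real.smoothTransition x = 0 := by
      rcases lt_or_ge x 0 with h | h
      · have : Real.smoothTransition =ᶠ[nhds x] fun _ => 0 := by
          filter_upwards [Iio_mem_nhds h] with y hy
          exact Real.smoothTransition.zero_of_nonpos (le_of_lt hy)
        rw [this.deriv_eq]; simp
      · have h1 : 1 < x := by
          by_contra h'
          exact hx ⟨h, not_lt.1 h'⟩
        have : Real.smoothTransition =ᶠ[nhds x] fun _ => 1 := by
          filter_upwards [Ioi_mem_nhds h1] with y hy
          exact Real.smoothTransition.one_of_one_le (le_of_lt hy)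
        rw [this.deriv_eq]; simp
    rw [this]; simp

lemma radial_bound (n : ℕ) (hn : 1 ≤ n) (p : ℝ) (hnp : (n : ℝ) ≤ p) (y : ℝ) (hy : 0 < y) :
    y ^ (n - 1) * (y / (1 + y ^ 2)) ^ p ≤ y / (1 + y ^ 2) := by
  have hq0 : 0 < y / (1 + y ^ 2) := by positivity
  have hq1 : y / (1 + y ^ 2) ≤ 1 := by
    rw [div_le_one (by positivity)]; nlinarith [sq_nonneg (y - 1)]
  have h1 : (y / (1 + y ^ 2)) ^ p ≤ (y / (1 + y ^ 2)) ^ n := by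
    rw [← Real.rpow_natCast (y / (1 + y ^ 2)) n]
    exact Real.rpow_le_rpow_of_exponent_ge hq0 hq1 hnp
  obtain ⟨m, rfl⟩ : ∃ m, n = m + 1 := ⟨n - 1, by omega⟩
  simp only [Nat.add_sub_cancel]
  have h2 : y * (y / (1 + y ^ 2)) ≤ 1 := by
    rw [← mul_div_assoc, div_le_one (by positivity)]; nlinarith
  calc y ^ m * (y / (1 + y ^ 2)) ^ p ≤ y ^ m * (y / (1 + y ^ 2)) ^ (m + 1) := by gcongr
    _ = (y * (y / (1 + y ^ 2))) ^ m * (y / (1 + y ^ 2)) := by rw [mul_pow, pow_succ]; ring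
    _ ≤ 1 * (y / (1 + y ^ 2)) := by
      gcongr
      exact pow_le_one₀ (by positivity) h2
    _ = _ := one_mul _

lemma cutoff_R (N : ℕ) (hN : 1 ≤ N) (p : ℝ) (hp : 1 < p) (hNp : (N : ℝ) ≤ p) (C : ℝ) (hC0 : 0 < C)
    (hC : ∀ x, |deriv Real.smoothTransition x| ≤ C) (R : ℝ) (hR : 0 < R) :
    ∃ η : EuclideanSpace ℝ (Fin N) → ℝ, ContDiff ℝ 1 η ∧ HasCompactSupport η ∧ (∀ x, 0 ≤ η x) ∧
      (∀ x, Real.log (1 + ‖x‖ ^ 2) ≤ R → η x = 1) ∧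
      ∫ x, ‖gradient η x‖ ^ p ≤
        (N * volume.real (ball (0 : EuclideanSpace ℝ (Fin N)) 1) * (2 * C) ^ p) * R ^ (-(p - 1)) := by
  have : Nonempty (Fin N) := ⟨⟨0, hN⟩⟩
  have hp0 : 0 < p := by linarith
  set A := Real.sqrt (Real.exp (2 * R) - 1) with hA
  have hE : 0 ≤ Real.exp (2 * R) - 1 := by
    have := Real.one_le_exp (x := 2 * R) (by linarith); linarith
  have hA0 : 0 ≤ A := Real.sqrt_nonneg _
  have hA2 : Real.log (1 + A ^ 2) = 2 * R := by
    rw [hA, Real.sq_sqrt hE, add_sub_cancel, Real.log_exp]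
  let g : EuclideanSpace ℝ (Fin N) → ℝ := fun x => 2 - Real.log (1 + ‖x‖ ^ 2) / R
  let η : EuclideanSpace ℝ (Fin N) → ℝ := fun x => Real.smoothTransition (g x)
  have hpos : ∀ x : EuclideanSpace ℝ (Fin N), 0 < 1 + ‖x‖ ^ 2 := fun x => by positivity
  have hg : ContDiff ℝ 1 g := by
    refine contDiff_const.sub (ContDiff.div_const (ContDiff.log ?_ fun x => (hpos x).ne') _)
    exact contDiff_const.add (contDiff_norm_sq ℝ)
  have hη : ContDiff ℝ 1 η := (Real.smoothTransition.contDiff (n := 1)).comp hg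
  have hsupp : tsupport η ⊆ closedBall 0 A := by
    refine closure_minimal (fun x hx => ?_) isClosed_closedBall
    by_contra hxA
    have hxA' : A < ‖x‖ := by simpa using hxA
    apply hx
    refine Real.smoothTransition.zero_of_nonpos ?_
    have : 2 * R ≤ Real.log (1 + ‖x‖ ^ 2) := by
      rw [← hA2]; exact Real.log_le_log (by positivity) (by gcongr)
    have : 2 ≤ Real.log (1 + ‖x‖ ^ 2) / R := by rwa [le_div_iff₀ hR]
    simp only [g]; linarith
  have hcs : HasCompactSupport η :=
    (isCompact_closedBall (0 : EuclideanSpace ℝ (Fin N)) A).of_isClosed_subset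
      (isClosed_tsupport _) hsupp
  have hgrad : ∀ x, ‖gradient η x‖ ≤ 2 * C / R * (‖x‖ / (1 + ‖x‖ ^ 2)) := by
    intro x
    have d1 : HasFDerivAt (fun x : EuclideanSpace ℝ (Fin N) => 1 + ‖x‖ ^ 2)
        (2 • (innerSL ℝ x)) x := (hasStrictFDerivAt_norm_sq x).hasFDerivAt.const_add 1
    have d2 : HasFDerivAt g _ x := ((d1.log (hpos x).ne').mul_const (R⁻¹)).const_sub 2
    have d3 : HasFDerivAt η _ x :=
      ((Real.smoothTransition.contDiff (n := 1)).differentiable one_ne_zero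
        (g x)).hasDerivAt.comp_hasFDerivAt x d2
    rw [norm_gradient_eq, d3.fderiv, norm_smul, norm_neg, norm_smul, norm_smul, ← Nat.cast_smul_eq_nsmul ℝ, norm_smul,
      innerSL_apply_norm, norm_inv, norm_inv, Real.norm_of_nonneg hR.le, Real.norm_of_nonneg (hpos x).le,
      Real.norm_eq_abs]
    calc _ ≤ C * (R⁻¹ * ((1 + ‖x‖ ^ 2)⁻¹ * (‖((2 : ℕ) : ℝ)‖ * ‖x‖))) := by gcongr; exact hC _
      _ = _ := by simp; field_simp
  refine ⟨η, hη, hcs, fun x => Real.smoothTransition.nonneg _, fun x hx => ?_, ?_⟩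
  · refine Real.smoothTransition.one_of_one_le ?_
    have : Real.log (1 + ‖x‖ ^ 2) / R ≤ 1 := by rwa [div_le_one hR]
    simp only [g]; linarith
  let f : ℝ → ℝ := (Set.Iic A).indicator fun y => (2 * C / R * (y / (1 + y ^ 2))) ^ p
  have hK : 0 ≤ 2 * C / R := by positivity
  let G : ℝ → ℝ := (Set.Ioc 0 A).indicator fun y => (2 * C / R) ^ p * (y / (1 + y ^ 2))
  have hcG : Continuous (fun y : ℝ => (2 * C / R) ^ p * (y / (1 + y ^ 2))) :=
    continuous_const.mul (continuous_id.div (by fun_prop) fun y => by positivity)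
  have iG : Integrable G :=
    IntegrableOn.integrable_indicator (hcG.integrableOn_Ioc) measurableSet_Ioc
  have hfG : ∀ y ∈ Set.Ioi (0:ℝ), y ^ (N - 1) • f y ≤ G y := by
    intro y hy
    have hy0 : 0 < y := hy
    by_cases hyA : y ≤ A
    · simp only [f, G, Set.indicator_of_mem (show y ∈ Set.Iic A from hyA),
        Set.indicator_of_mem (show y ∈ Set.Ioc 0 A from ⟨hy, hyA⟩), smul_eq_mul]
      rw [Real.mul_rpow hK (by positivity)]
      have := radial_bound N hN p hNp y hy0
      have h3 : 0 ≤ (2 * C / R) ^ p := Real.rpow_nonneg hK _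
      nlinarith [mul_le_mul_of_nonneg_left this h3]
    · simp only [f, G, Set.indicator_of_notMem (show y ∉ Set.Iic A from hyA),
        Set.indicator_of_notMem (show y ∉ Set.Ioc 0 A from fun h => hyA h.2), smul_zero, le_refl]
  have hf0 : ∀ y ∈ Set.Ioi (0:ℝ), 0 ≤ y ^ (N - 1) • f y := by
    intro y hy
    have hy0 : 0 < y := hy
    refine smul_nonneg (by positivity) (Set.indicator_apply_nonneg (fun _ => ?_))
    apply Real.rpow_nonneg; positivity
  have hfm : Measurable f := by
    refine Measurable.indicator ?_ measurableSet_Iic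
    fun_prop
  have i1 : IntegrableOn (fun y : ℝ => y ^ (N - 1) • f y) (Set.Ioi 0) := by
    refine Integrable.mono' iG.integrableOn ?_ ?_
    · exact ((measurable_id.pow_const _).smul hfm).aestronglyMeasurable
    · filter_upwards [ae_restrict_mem measurableSet_Ioi] with y hy
      rw [Real.norm_of_nonneg (hf0 y hy)]
      exact hfG y hy
  have hfr : Module.finrank ℝ (EuclideanSpace ℝ (Fin N)) = N := by simp
  have i2 : Integrable (fun x : EuclideanSpace ℝ (Fin N) => f ‖x‖) := by
    rw [integrable_fun_norm_addHaar volume, hfr]; exact i1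
  have h1 : ∫ x, ‖gradient η x‖ ^ p ≤ ∫ x : EuclideanSpace ℝ (Fin N), f ‖x‖ := by
    refine integral_mono_of_nonneg (Filter.Eventually.of_forall fun x => by positivity) i2
      (Filter.Eventually.of_forall fun x => ?_)
    simp only [f]
    by_cases hx : ‖x‖ ≤ A
    · rw [Set.indicator_of_mem (show ‖x‖ ∈ Set.Iic A from hx)]
      exact Real.rpow_le_rpow (norm_nonneg _) (hgrad x) hp0.le
    · rw [Set.indicator_of_notMem (show ‖x‖ ∉ Set.Iic A from hx),
        gradient_zero_of_notMem η hsupp (by simpa using hx), norm_zero, Real.zero_rpow hp0.ne']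
  have hint : ∫ y in (0:ℝ)..A, y / (1 + y ^ 2) = R := by
    have hd : ∀ y ∈ Set.uIcc 0 A, HasDerivAt (fun y : ℝ => Real.log (1 + y ^ 2) / 2)
        (y / (1 + y ^ 2)) y := by
      intro y _
      have := (((hasDerivAt_pow 2 y).const_add 1).log (by positivity)).div_const 2
      refine this.congr_deriv ?_
      have : 1 + y ^ 2 ≠ 0 := by positivity
      norm_num
      field_simp
    rw [intervalIntegral.integral_eq_sub_of_hasDerivAt hd]
    · rw [hA2]; simp
    · exact (continuous_id.div (by fun_prop) fun y => by positivity).intervalIntegrable _ _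
  have h2 : ∫ y in Set.Ioi (0:ℝ), y ^ (N - 1) • f y ≤ (2 * C / R) ^ p * R := by
    calc _ ≤ ∫ y in Set.Ioi (0:ℝ), G y :=
          setIntegral_mono_on i1 iG.integrableOn measurableSet_Ioi hfG
      _ = ∫ y in Set.Ioc 0 A, (2 * C / R) ^ p * (y / (1 + y ^ 2)) := by
          rw [setIntegral_indicator measurableSet_Ioc]
          congr 2
          exact Set.inter_eq_right.2 fun y hy => hy.1
      _ = _ := by
          rw [integral_const_mul, ← intervalIntegral.integral_of_le hA0, hint]
  rw [integral_fun_norm_addHaar volume f, hfr, nsmul_eq_mul, smul_eq_mul] at h1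
  refine h1.trans ?_
  have h3 : (2 * C / R) ^ p * R = (2 * C) ^ p * R ^ (-(p - 1)) := by
    rw [Real.div_rpow (by positivity) hR.le, show -(p - 1) = -p + 1 by ring,
      Real.rpow_add_one hR.ne', Real.rpow_neg hR.le]
    ring
  rw [h3] at h2
  calc _ ≤ (N : ℝ) * (volume.real (ball (0 : EuclideanSpace ℝ (Fin N)) 1) *
        ((2 * C) ^ p * R ^ (-(p - 1)))) := by gcongr
    _ = _ := by ring

/-- For `N ≤ p`, any C¹ weak solution of `-Δ_p u ≥ 0` in `ℝ^N` which is bounded below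
is constant. -/
theorem liouville_p_superharmonic_low_dim
    (N : ℕ) (hN : 1 ≤ N) (p : ℝ) (hp : 1 < p) (hNp : (N : ℝ) ≤ p)
    (u : EuclideanSpace ℝ (Fin N) → ℝ)
    (hu : ContDiff ℝ 1 u)
    (hbd : ∃ M : ℝ, ∀ x, M ≤ u x)
    (hsuper : ∀ φ : EuclideanSpace ℝ (Fin N) → ℝ,
      ContDiff ℝ (⊤ : ℕ∞) φ → HasCompactSupport φ → (∀ x, 0 ≤ φ x) →
      0 ≤ ∫ x, ‖gradient u x‖ ^ (p - 2) * ⟪gradient u x, gradient φ x⟫) :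
    ∃ c : ℝ, ∀ x, u x = c := by
  obtain ⟨M, hM⟩ := hbd
  obtain ⟨C, hC0, hC⟩ := smoothTransition_deriv_bound
  have hp0 : 0 < p := by linarith
  have hv : ∀ x, 0 < u x - M + 1 := fun x => by linarith [hM x]
  have c1 := continuous_gradient_of u hu
  have hzero : ∀ x, fderiv ℝ u x = 0 := by
    intro x₀
    by_contra hne
    let h : EuclideanSpace ℝ (Fin N) → ℝ := fun x => (‖gradient u x‖ / (u x - M + 1)) ^ p
    have hh0 : ∀ x, 0 ≤ h x := fun x => Real.rpow_nonneg (div_nonneg (norm_nonneg _) (hv x).le) _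
    have hhc : Continuous h := by
      refine Continuous.rpow_const ?_ fun x => Or.inr hp0.le
      exact c1.norm.div ((hu.continuous.sub continuous_const).add continuous_const)
        fun x => (hv x).ne'
    let b : ContDiffBump x₀ := ⟨1, 2, one_pos, one_lt_two⟩
    have hcs : HasCompactSupport (fun x => b x * h x) := b.hasCompactSupport.mul_right
    have hcc : Continuous (fun x => b x * h x) := b.continuous.mul hhc
    have hpos : 0 < ∫ x, b x * h x := by
      refine hcc.integral_pos_of_hasCompactSupport_nonneg_nonzero (x := x₀) hcs
        (fun x => mul_nonneg b.nonneg (hh0 x)) ?_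
      have hb : b x₀ = 1 := b.one_of_mem_closedBall (mem_closedBall_self zero_le_one)
      rw [hb, one_mul]
      refine (Real.rpow_pos_of_pos (div_pos ?_ (hv x₀)) _).ne'
      rw [norm_gradient_eq]
      exact norm_pos_iff.2 hne
    set I := ∫ x, b x * h x with hI
    set D := p * (2 * p / (p - 1)) ^ (p - 1) *
      (N * volume.real (ball (0 : EuclideanSpace ℝ (Fin N)) 1) * (2 * C) ^ p) with hD
    have hlim : Filter.Tendsto (fun R : ℝ => D * R ^ (-(p - 1))) Filter.atTop (nhds 0) := by
      simpa using (tendsto_rpow_neg_atTop (y := p - 1) (by linarith)).const_mul D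
    have hI2 : 0 < (p - 1) / 2 * I := mul_pos (by linarith) hpos
    obtain ⟨R, hR1, hR2, hR3⟩ := ((hlim.eventually (gt_mem_nhds hI2)).and
      ((Filter.eventually_gt_atTop 0).and
        (Filter.eventually_ge_atTop (Real.log (1 + (‖x₀‖ + 2) ^ 2))))).exists
    obtain ⟨η, e1, e2, e3, e4, e5⟩ := cutoff_R N hN p hp hNp C hC0 hC R hR2
    have hcac := caccioppoli p hp u hu M hM hsuper η e1 e2 e3
    have hmono : I ≤ ∫ x, (η x * ‖gradient u x‖ / (u x - M + 1)) ^ p := by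
      refine integral_mono (hcc.integrable_of_hasCompactSupport hcs) ?_ fun x => ?_
      · refine Continuous.integrable_of_hasCompactSupport ?_ ?_
        · refine Continuous.rpow_const ?_ fun x => Or.inr hp0.le
          exact (e1.continuous.mul c1.norm).div
            ((hu.continuous.sub continuous_const).add continuous_const) fun x => (hv x).ne'
        · refine HasCompactSupport.intro e2 (fun x hx => ?_)
          simp [image_eq_zero_of_notMem_tsupport hx, Real.zero_rpow hp0.ne']
      · simp only
        by_cases hx : x ∈ ball x₀ 2
        · have hxn : ‖x‖ ≤ ‖x₀‖ + 2 := by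
            have h1 : ‖x - x₀‖ < 2 := by simpa [dist_eq_norm] using hx
            have h2 := norm_le_norm_add_norm_sub' x x₀
            linarith
          have : η x = 1 := by
            refine e4 x (le_trans (Real.log_le_log (by positivity) ?_) hR3)
            gcongr
          rw [this, one_mul]
          exact mul_le_of_le_one_left (hh0 x) b.le_one
        · have hb0 : b x = 0 := b.zero_of_le_dist (by simpa [b] using hx)
          rw [hb0, zero_mul]
          exact Real.rpow_nonneg (div_nonneg (mul_nonneg (e3 x) (norm_nonneg _)) (hv x).le) _
    have hK : 0 ≤ p * (2 * p / (p - 1)) ^ (p - 1) := by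
      have : 0 ≤ 2 * p / (p - 1) := div_nonneg (by linarith) (by linarith)
      positivity
    have f1 := mul_le_mul_of_nonneg_left e5 hK
    have f2 : (p - 1) / 2 * I ≤
        (p - 1) / 2 * ∫ x, (η x * ‖gradient u x‖ / (u x - M + 1)) ^ p :=
      mul_le_mul_of_nonneg_left hmono (by linarith)
    rw [← mul_assoc, ← hD] at f1
    linarith
  exact ⟨u 0, fun x => is_const_of_fderiv_eq_zero (hu.differentiable one_ne_zero) hzero x 0⟩
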